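/- arXiv:math/0112155 — 2 statements merged into one kernel-verified Lean document; each statement's English description precedes it below -/
import Mathlib

section
/- Let I ⊆ B⁺ be a subspace of finite codimension and T_I = {f ∈ B' : f(I) = 0}. Then: (1) if BI ⊆ I and T_I ⊆ B°, then Δ(T_I) ⊆ B° ⊗ T_I; (2) if Δ̄(I) ⊆ I ⊗ Ā, then T_I K ⊆ T_I; (3) if BI ⊆ I and Δ̄(I) ⊆ I ⊗ Ā, then T_I ⊆ B°; (4) dim T_I = dim(B⁺/I) + 1; (5) I_{T_I} = I. -/
noncomputable section

open scoped TensorProduct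

variable {U A : Type} [Ring U] [HopfAlgebra ℂ U] [Ring A] [HopfAlgebra ℂ A]

/-- For a pairing `pair : U × A → ℂ` and `k : U`, the operator
`a ↦ ⟨k, a₍₁₎⟩ a₍₂₎` on `A`. -/
def hitL (pair : U →ₗ[ℂ] A →ₗ[ℂ] ℂ) (k : U) : A →ₗ[ℂ] A :=
  TensorProduct.lift ((LinearMap.lsmul ℂ A).comp (pair k)) ∘ₗ Coalgebra.comul (R := ℂ)

/-- The subspace `B = {b ∈ A | ⟨k, b₍₁₎⟩ b₍₂₎ = 0 for all k ∈ K⁺}` of invariants. -/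
def invSubmodule (pair : U →ₗ[ℂ] A →ₗ[ℂ] ℂ) (K : Subalgebra ℂ U) : Submodule ℂ A :=
  ⨅ k : ↥K,
    LinearMap.ker (hitL pair ((k : U) - algebraMap ℂ U (Coalgebra.counit (R := ℂ) (k : U))))

/-- The subspace `A·B⁺ ⊆ A`. -/
def ABp (Bsub : Subalgebra ℂ A) : Submodule ℂ A :=
  Submodule.span ℂ
    {x : A | ∃ a : A, ∃ b ∈ Bsub, Coalgebra.counit (R := ℂ) b = 0 ∧ x = a * b}

/-- The map `Δ̄ : B → A ⊗ Ā`, where `Ā = A/AB⁺`, given by the comultiplication of `A`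
followed by the canonical projection in the second tensor factor. -/
def DbarB (Bsub : Subalgebra ℂ A) :
    ↥Bsub →ₗ[ℂ] A ⊗[ℂ] (A ⧸ ABp Bsub) :=
  (TensorProduct.map LinearMap.id (ABp Bsub).mkQ) ∘ₗ (Coalgebra.comul (R := ℂ)) ∘ₗ
    Bsub.val.toLinearMap

/-- The counit of `A` restricted to the subalgebra `B`. -/
def counitB (Bsub : Subalgebra ℂ A) : Module.Dual ℂ ↥Bsub :=
  (Coalgebra.counit (R := ℂ) (A := A)) ∘ₗ Bsub.val.toLinearMap

/-- The augmentation ideal `B⁺ = B ∩ ker ε` of `B`. -/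
def BplusB (Bsub : Subalgebra ℂ A) : Submodule ℂ ↥Bsub :=
  LinearMap.ker (counitB Bsub)

/-- `Δ̄(I) ⊆ I ⊗ Ā`. -/
def DbarStable (Bsub : Subalgebra ℂ A) (I : Submodule ℂ ↥Bsub) : Prop :=
  ∀ x ∈ I, DbarB Bsub x ∈
    LinearMap.range (TensorProduct.map (Bsub.val.toLinearMap ∘ₗ I.subtype)
      (LinearMap.id (R := ℂ) (M := A ⧸ ABp Bsub)))

/-- Membership in the dual coalgebra `B°` of `B`: a functional `f ∈ B'` lies in `B°`
iff `(a,b) ↦ f(ab)` admits a finite decomposition `f(ab) = Σᵢ gᵢ(a) hᵢ(b)`. -/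
def IsDualCoalgElemB (Bsub : Subalgebra ℂ A) (f : Module.Dual ℂ ↥Bsub) : Prop :=
  ∃ (n : ℕ) (g h : Fin n → Module.Dual ℂ ↥Bsub),
    ∀ a b : ↥Bsub, f (a * b) = ∑ i, g i a * h i b

/-- `Δ(T) ⊆ B° ⊗ T` for a subspace `T` of `B'` consisting of elements of `B°`. -/
def DeltaInto (Bsub : Subalgebra ℂ A) (T : Submodule ℂ (Module.Dual ℂ ↥Bsub)) : Prop :=
  ∀ f ∈ T, ∃ (n : ℕ) (g h : Fin n → Module.Dual ℂ ↥Bsub),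
    (∀ i, IsDualCoalgElemB Bsub (g i)) ∧ (∀ i, h i ∈ T) ∧
    ∀ a b : ↥Bsub, f (a * b) = ∑ i, g i a * h i b

/-- `g` is the result of the right action of `k ∈ K ⊆ U` on the functional `f ∈ B'`:
`g(b) = f(b₍₀₎) ⟨k, b₍₁₎⟩`, where `Δ(b) = b₍₀₎ ⊗ b₍₁₎ ∈ B ⊗ A` (which represents the
coaction `B → B ⊗ Ā`; note that `k ∈ K` descends to `Ā = A/AB⁺`). -/
def IsDualAct (pair : U →ₗ[ℂ] A →ₗ[ℂ] ℂ) (Bsub : Subalgebra ℂ A)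
    (f : Module.Dual ℂ ↥Bsub) (k : U) (g : Module.Dual ℂ ↥Bsub) : Prop :=
  ∀ (b : ↥Bsub) (c : ↥Bsub ⊗[ℂ] A),
    TensorProduct.map Bsub.val.toLinearMap LinearMap.id c =
      Coalgebra.comul (R := ℂ) (b : A) →
    g b = TensorProduct.lift (((LinearMap.mul ℂ ℂ) ∘ₗ f).compl₂ (pair k)) c

/-- `T` is stable under the right action of `K` on `B'`. -/
def KStable (pair : U →ₗ[ℂ] A →ₗ[ℂ] ℂ) (K : Subalgebra ℂ U) (Bsub : Subalgebra ℂ A)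
    (T : Submodule ℂ (Module.Dual ℂ ↥Bsub)) : Prop :=
  ∀ f ∈ T, ∀ k ∈ K, ∀ g : Module.Dual ℂ ↥Bsub, IsDualAct pair Bsub f k g → g ∈ T

/-- The annihilator `T_I ⊆ B'` of a subspace `I ⊆ B`. -/
def TofI (Bsub : Subalgebra ℂ A) (I : Submodule ℂ ↥Bsub) :
    Submodule ℂ (Module.Dual ℂ ↥Bsub) :=
  ⨅ x : ↥I, LinearMap.ker (Module.Dual.eval ℂ ↥Bsub (x : ↥Bsub))

/-- The common kernel `I_T ⊆ B` of a subspace `T ⊆ B'`. -/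
def IofT (Bsub : Subalgebra ℂ A) (T : Submodule ℂ (Module.Dual ℂ ↥Bsub)) :
    Submodule ℂ ↥Bsub :=
  ⨅ f : ↥T, LinearMap.ker (f : Module.Dual ℂ ↥Bsub)



section Invariants

open TensorProduct

theorem tensor_mem_range_rTensor_iInf_ker {ι V W X : Type*}
    [AddCommGroup V] [Module ℂ V] [AddCommGroup W] [Module ℂ W] [AddCommGroup X] [Module ℂ X]
    (φ : ι → V →ₗ[ℂ] W) (N : Submodule ℂ V) (hN : N = ⨅ i, LinearMap.ker (φ i))
    (x : V ⊗[ℂ] X) (hx : ∀ i, TensorProduct.map (φ i) LinearMap.id x = 0) :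
    ∃ c : N ⊗[ℂ] X, TensorProduct.map N.subtype LinearMap.id c = x := by
  classical
  let e := Module.Free.chooseBasis ℂ X
  obtain ⟨m, rfl⟩ := (TensorProduct.equivFinsuppOfBasisRight (M := V) e).symm.surjective x
  have hm : ∀ j, m j ∈ N := by
    intro j
    rw [hN, Submodule.mem_iInf]
    intro i
    have h := congrArg (fun y => TensorProduct.equivFinsuppOfBasisRight (M := W) e y j) (hx i)
    rw [LinearMap.mem_ker]
    have hm' : (TensorProduct.equivFinsuppOfBasisRight (M := V) e).symm m =
        m.sum fun i v => v ⊗ₜ[ℂ] e i := by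
      simp
    rw [hm', Finsupp.sum, map_sum] at h
    simp only [TensorProduct.map_tmul, map_sum, Finsupp.finsetSum_apply,
      TensorProduct.equivFinsuppOfBasisRight_apply_tmul_apply, LinearMap.id_apply,
      Module.Basis.repr_self, map_zero, Finsupp.coe_zero, Pi.zero_apply] at h
    have h' : m j ≠ 0 → φ i (m j) = 0 := by simpa [Finsupp.single_apply] using h
    by_cases h0 : m j = 0
    · rw [h0, map_zero]
    · exact h' h0
  refine ⟨∑ j ∈ m.support, (⟨m j, hm j⟩ : N) ⊗ₜ[ℂ] e j, ?_⟩
  simp [Finsupp.sum]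

theorem counit_hitL (pair : U →ₗ[ℂ] A →ₗ[ℂ] ℂ) (k : U) (a : A) :
    Coalgebra.counit (R := ℂ) (hitL pair k a) = pair k a := by
  have h : (Coalgebra.counit (R := ℂ) (A := A)) ∘ₗ
      TensorProduct.lift ((LinearMap.lsmul ℂ A).comp (pair k)) =
      pair k ∘ₗ (TensorProduct.rid ℂ A).toLinearMap ∘ₗ
        LinearMap.lTensor A (Coalgebra.counit (R := ℂ) (A := A)) := by
    ext x y
    simp [mul_comm]
  have h2 := LinearMap.congr_fun h (Coalgebra.comul (R := ℂ) a)
  simpa [hitL] using h2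

theorem map_hitL_comul (pair : U →ₗ[ℂ] A →ₗ[ℂ] ℂ) (k : U) (a : A) :
    TensorProduct.map (hitL pair k) LinearMap.id (Coalgebra.comul (R := ℂ) a) =
      Coalgebra.comul (R := ℂ) (hitL pair k a) := by
  let L : A ⊗[ℂ] A →ₗ[ℂ] A := TensorProduct.lift ((LinearMap.lsmul ℂ A).comp (pair k))
  have h : (TensorProduct.map L (LinearMap.id (R := ℂ) (M := A))) ∘ₗ
        (TensorProduct.assoc ℂ A A A).symm.toLinearMap =
      TensorProduct.lift ((LinearMap.lsmul ℂ (A ⊗[ℂ] A)).comp (pair k)) := by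
    ext x y z
    simp [L, TensorProduct.smul_tmul']
  have h' : (Coalgebra.comul (R := ℂ) (A := A)) ∘ₗ L =
      TensorProduct.lift ((LinearMap.lsmul ℂ (A ⊗[ℂ] A)).comp (pair k)) ∘ₗ
        LinearMap.lTensor A (Coalgebra.comul (R := ℂ) (A := A)) := by
    ext x y
    simp [L]
  have h1 : TensorProduct.map (hitL pair k) LinearMap.id (Coalgebra.comul (R := ℂ) a) =
      TensorProduct.map L LinearMap.id
        (LinearMap.rTensor A (Coalgebra.comul (R := ℂ)) (Coalgebra.comul (R := ℂ) a)) := by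
    rw [LinearMap.rTensor, ← LinearMap.comp_apply (TensorProduct.map L _), ← TensorProduct.map_comp]
    rfl
  have h2 : Coalgebra.comul (R := ℂ) (hitL pair k a) = ((Coalgebra.comul (R := ℂ) (A := A)) ∘ₗ L)
      (Coalgebra.comul (R := ℂ) a) := rfl
  rw [h1, h2, h', ← h, LinearMap.comp_apply, LinearMap.comp_apply, ← Coalgebra.coassoc_apply]
  simp

theorem exists_comul_lift (pair : U →ₗ[ℂ] A →ₗ[ℂ] ℂ) (K : Subalgebra ℂ U) (Bsub : Subalgebra ℂ A)
    (hB : Subalgebra.toSubmodule Bsub = invSubmodule pair K) (b : ↥Bsub) :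
    ∃ c : ↥Bsub ⊗[ℂ] A, TensorProduct.map Bsub.val.toLinearMap LinearMap.id c =
      Coalgebra.comul (R := ℂ) (b : A) := by
  have hb : (b : A) ∈ invSubmodule pair K := hB ▸ b.2
  refine tensor_mem_range_rTensor_iInf_ker _ (Subalgebra.toSubmodule Bsub) hB _ fun k => ?_
  have hk : hitL pair _ (b : A) = 0 := (Submodule.mem_iInf _).1 hb k
  rw [map_hitL_comul, hk, map_zero]

theorem pair_apply_of_mem_inv (pair : U →ₗ[ℂ] A →ₗ[ℂ] ℂ)
    (hpair_oneU : ∀ a : A, pair 1 a = Coalgebra.counit (R := ℂ) a) (K : Subalgebra ℂ U)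
    {b : A} (hb : b ∈ invSubmodule pair K) {k : U} (hk : k ∈ K) :
    pair k b = Coalgebra.counit (R := ℂ) k * Coalgebra.counit (R := ℂ) b := by
  have h : hitL pair (k - algebraMap ℂ U (Coalgebra.counit (R := ℂ) k)) b = 0 :=
    (Submodule.mem_iInf _).1 hb ⟨k, hk⟩
  have h' := counit_hitL pair (k - algebraMap ℂ U (Coalgebra.counit (R := ℂ) k)) b
  rw [h, map_zero, map_sub, Algebra.algebraMap_eq_smul_one, map_smul, LinearMap.sub_apply,
    LinearMap.smul_apply, hpair_oneU, smul_eq_mul] at h'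
  exact sub_eq_zero.1 h'.symm

theorem ABp_le_ker_pair (pair : U →ₗ[ℂ] A →ₗ[ℂ] ℂ)
    (hpair_mulA : ∀ (x : U) (a b : A), pair x (a * b) =
      LinearMap.mul' ℂ ℂ (TensorProduct.map (pair.flip a) (pair.flip b)
        (Coalgebra.comul (R := ℂ) x)))
    (hpair_oneU : ∀ a : A, pair 1 a = Coalgebra.counit (R := ℂ) a)
    (K : Subalgebra ℂ U)
    (hKcoideal : ∀ k ∈ K, Coalgebra.comul (R := ℂ) k ∈
      LinearMap.range (TensorProduct.map (LinearMap.id (R := ℂ) (M := U))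
        (Subalgebra.toSubmodule K).subtype))
    (Bsub : Subalgebra ℂ A)
    (hB : Subalgebra.toSubmodule Bsub = invSubmodule pair K) {k : U} (hk : k ∈ K) :
    ABp Bsub ≤ LinearMap.ker (pair k) := by
  refine Submodule.span_le.2 ?_
  rintro _ ⟨a, b, hb, hεb, rfl⟩
  obtain ⟨t, ht⟩ := hKcoideal k hk
  have hbK : pair.flip b ∘ₗ (Subalgebra.toSubmodule K).subtype = 0 := by
    ext k'
    have hb' : b ∈ invSubmodule pair K := hB ▸ hb
    simpa [hεb] using pair_apply_of_mem_inv pair hpair_oneU K hb' k'.2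
  change pair k (a * b) = 0
  rw [hpair_mulA, ← ht, ← LinearMap.comp_apply (TensorProduct.map _ _), ← TensorProduct.map_comp,
    hbK, TensorProduct.map_zero_right, LinearMap.zero_apply, map_zero]

end Invariants

section Annihilators

theorem TofI_eq_dualAnnihilator (Bsub : Subalgebra ℂ A) (I : Submodule ℂ ↥Bsub) :
    TofI Bsub I = I.dualAnnihilator := by
  ext f
  simp [TofI, Submodule.mem_dualAnnihilator]

theorem IofT_eq_dualCoannihilator (Bsub : Subalgebra ℂ A)
    (T : Submodule ℂ (Module.Dual ℂ ↥Bsub)) : IofT Bsub T = T.dualCoannihilator := by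
  ext x
  simp [IofT, Submodule.mem_dualCoannihilator]

theorem finrank_quotient_eq_finrank_ker_quotient_add_one {V : Type*} [AddCommGroup V] [Module ℂ V]
    (ε : Module.Dual ℂ V) (hε : ε ≠ 0) (I : Submodule ℂ V) (hI : I ≤ LinearMap.ker ε)
    [FiniteDimensional ℂ (V ⧸ I)] :
    Module.finrank ℂ (V ⧸ I) =
      Module.finrank ℂ (↥(LinearMap.ker ε) ⧸ I.comap (LinearMap.ker ε).subtype) + 1 := by
  have hne : I.liftQ ε hI ≠ 0 := by
    rintro h
    exact hε (by rw [← I.liftQ_mkQ ε hI, h, LinearMap.zero_comp])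
  have e : (↥(LinearMap.ker ε) ⧸ I.comap (LinearMap.ker ε).subtype) ≃ₗ[ℂ]
      ↥(LinearMap.ker (I.liftQ ε hI)) := by
    have hker : LinearMap.ker (I.mkQ ∘ₗ (LinearMap.ker ε).subtype) =
        I.comap (LinearMap.ker ε).subtype := by
      rw [LinearMap.ker_comp, Submodule.ker_mkQ]
    have hrange : LinearMap.range (I.mkQ ∘ₗ (LinearMap.ker ε).subtype) =
        LinearMap.ker (I.liftQ ε hI) := by
      rw [LinearMap.range_comp, Submodule.range_subtype, Submodule.ker_liftQ]
    exact (Submodule.quotEquivOfEq _ _ hker.symm).trans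
      ((LinearMap.quotKerEquivRange _).trans (LinearEquiv.ofEq _ _ hrange))
  rw [e.finrank_eq]
  exact (Module.Dual.finrank_ker_add_one_of_ne_zero hne).symm

/-- If `I` is a left ideal of finite codimension, then every functional vanishing on `I`
satisfies `f(ab) = ∑ᵢ f(abᵢ) hᵢ(b)` with `bᵢ` representing a basis of `B/I` and `hᵢ` the
dual basis. -/
theorem exists_apply_mul_eq_sum (Bsub : Subalgebra ℂ A) (I : Submodule ℂ ↥Bsub)
    [FiniteDimensional ℂ (↥Bsub ⧸ I)] (hI : ∀ b : ↥Bsub, ∀ x ∈ I, b * x ∈ I) :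
    ∃ (n : ℕ) (c : Fin n → ↥Bsub) (h : Fin n → Module.Dual ℂ ↥Bsub),
      (∀ i, h i ∈ TofI Bsub I) ∧
      ∀ f ∈ TofI Bsub I, ∀ a b : ↥Bsub, f (a * b) = ∑ i, f (a * c i) * h i b := by
  let e := Module.finBasis ℂ (↥Bsub ⧸ I)
  choose c hc using fun i => I.mkQ_surjective (e i)
  refine ⟨_, c, fun i => e.coord i ∘ₗ I.mkQ, fun i => ?_, fun f hf a b => ?_⟩
  · rw [TofI_eq_dualAnnihilator, Submodule.mem_dualAnnihilator]
    intro x hx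
    simp [(Submodule.Quotient.mk_eq_zero I).2 hx]
  · rw [TofI_eq_dualAnnihilator, Submodule.mem_dualAnnihilator] at hf
    have hb : b - ∑ i, e.coord i (I.mkQ b) • c i ∈ I := by
      rw [← Submodule.Quotient.mk_eq_zero, ← Submodule.mkQ_apply, map_sub, map_sum]
      simp only [map_smul, hc, Module.Basis.coord_apply, e.sum_repr, sub_self]
    have h0 := hf _ (hI a _ hb)
    rw [mul_sub, map_sub, sub_eq_zero, Finset.mul_sum, map_sum] at h0
    rw [h0]
    refine Finset.sum_congr rfl fun i _ => ?_
    rw [mul_smul_comm, map_smul, smul_eq_mul, mul_comm]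
    rfl

theorem isDualCoalgElemB_of_left_ideal (Bsub : Subalgebra ℂ A) (I : Submodule ℂ ↥Bsub)
    [FiniteDimensional ℂ (↥Bsub ⧸ I)] (hI : ∀ b : ↥Bsub, ∀ x ∈ I, b * x ∈ I)
    {f : Module.Dual ℂ ↥Bsub} (hf : f ∈ TofI Bsub I) : IsDualCoalgElemB Bsub f := by
  obtain ⟨n, c, h, -, hfc⟩ := exists_apply_mul_eq_sum Bsub I hI
  exact ⟨n, fun i => f ∘ₗ LinearMap.mulRight ℂ (c i), h, hfc f hf⟩

theorem deltaInto_of_left_ideal (Bsub : Subalgebra ℂ A) (I : Submodule ℂ ↥Bsub)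
    [FiniteDimensional ℂ (↥Bsub ⧸ I)] (hI : ∀ b : ↥Bsub, ∀ x ∈ I, b * x ∈ I) :
    DeltaInto Bsub (TofI Bsub I) := by
  intro f hf
  obtain ⟨n, c, h, hh, hfc⟩ := exists_apply_mul_eq_sum Bsub I hI
  refine ⟨n, fun i => f ∘ₗ LinearMap.mulRight ℂ (c i), h, fun i => ?_, hh, hfc f hf⟩
  refine ⟨n, fun j => f ∘ₗ LinearMap.mulRight ℂ (c j),
    fun j => h j ∘ₗ LinearMap.mulRight ℂ (c i), fun a b => ?_⟩
  simpa [mul_assoc] using hfc f hf a (b * c i)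

end Annihilators

theorem KStable_TofI (pair : U →ₗ[ℂ] A →ₗ[ℂ] ℂ) (K : Subalgebra ℂ U) (Bsub : Subalgebra ℂ A)
    (hB : Subalgebra.toSubmodule Bsub = invSubmodule pair K)
    (hpair : ∀ k ∈ K, ABp Bsub ≤ LinearMap.ker (pair k))
    (I : Submodule ℂ ↥Bsub) (hI : DbarStable Bsub I) : KStable pair K Bsub (TofI Bsub I) := by
  intro f hf k hk g hg
  rw [TofI_eq_dualAnnihilator, Submodule.mem_dualAnnihilator] at hf ⊢
  intro x hx
  obtain ⟨c, hc⟩ := exists_comul_lift pair K Bsub hB x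
  rw [hg x c hc]
  obtain ⟨c', hc'⟩ := hI x hx
  have hinj : Function.Injective (TensorProduct.map Bsub.val.toLinearMap
      (LinearMap.id (R := ℂ) (M := A ⧸ ABp Bsub))) :=
    Module.Flat.rTensor_preserves_injective_linearMap _ Subtype.val_injective
  have hcc : TensorProduct.map LinearMap.id (ABp Bsub).mkQ c =
      TensorProduct.map I.subtype LinearMap.id c' := by
    apply hinj
    have h1 : DbarB Bsub x = TensorProduct.map LinearMap.id (ABp Bsub).mkQ
        (Coalgebra.comul (R := ℂ) (x : A)) := rfl
    rw [h1, ← hc] at hc'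
    simp only [← LinearMap.comp_apply, ← TensorProduct.map_comp, LinearMap.comp_id,
      LinearMap.id_comp] at hc' ⊢
    exact hc'.symm
  let kbar := (ABp Bsub).liftQ (pair k) (hpair k hk)
  have h1 : TensorProduct.lift (((LinearMap.mul ℂ ℂ) ∘ₗ f).compl₂ (pair k)) =
      TensorProduct.lift (((LinearMap.mul ℂ ℂ) ∘ₗ f).compl₂ kbar) ∘ₗ
        TensorProduct.map LinearMap.id (ABp Bsub).mkQ := by
    ext a b
    simp [kbar]
  have h2 : TensorProduct.lift (((LinearMap.mul ℂ ℂ) ∘ₗ f).compl₂ kbar) ∘ₗ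
        TensorProduct.map I.subtype LinearMap.id = 0 := by
    apply TensorProduct.ext'
    intro a b
    simp [hf _ a.2]
  rw [h1, LinearMap.comp_apply, hcc, ← LinearMap.comp_apply, h2, LinearMap.zero_apply]

/-- first Proposition of Section 1.  Let `I ⊆ B⁺` be a subspace of
finite codimension and `T_I = {f ∈ B' : f(I) = 0}`.  Then:
(1) if `BI ⊆ I` and `T_I ⊆ B°`, then `Δ(T_I) ⊆ B° ⊗ T_I`;
(2) if `Δ̄(I) ⊆ I ⊗ Ā`, then `T_I K ⊆ T_I`;
(3) if `BI ⊆ I` and `Δ̄(I) ⊆ I ⊗ Ā`, then `T_I ⊆ B°`;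
(4) `dim T_I = dim(B⁺/I) + 1`;  (5) `I_{T_I} = I`. -/
theorem properties_of_TofI
    (pair : U →ₗ[ℂ] A →ₗ[ℂ] ℂ)
    (hpair_mulU : ∀ (x y : U) (a : A), pair (x * y) a =
      LinearMap.mul' ℂ ℂ (TensorProduct.map (pair x) (pair y) (Coalgebra.comul (R := ℂ) a)))
    (hpair_mulA : ∀ (x : U) (a b : A), pair x (a * b) =
      LinearMap.mul' ℂ ℂ (TensorProduct.map (pair.flip a) (pair.flip b)
        (Coalgebra.comul (R := ℂ) x)))
    (hpair_oneU : ∀ a : A, pair 1 a = Coalgebra.counit (R := ℂ) a)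
    (hpair_oneA : ∀ x : U, pair x 1 = Coalgebra.counit (R := ℂ) x)
    (hpair_antipode : ∀ (x : U) (a : A),
      pair (HopfAlgebra.antipode (R := ℂ) x) a = pair x (HopfAlgebra.antipode (R := ℂ) a))
    (hsep : ∀ x : U, (∀ a : A, pair x a = 0) → x = 0)
    (hSbij : Function.Bijective (HopfAlgebra.antipode (R := ℂ) (A := U)))
    (K : Subalgebra ℂ U)
    (hKcoideal : ∀ k ∈ K, Coalgebra.comul (R := ℂ) k ∈
      LinearMap.range (TensorProduct.map (LinearMap.id (R := ℂ) (M := U))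
        (Subalgebra.toSubmodule K).subtype))
    (hAspan : ∀ a : A, a ∈ Submodule.span ℂ
      {x : A | ∃ (n : ℕ) (ρ : U →ₐ[ℂ] Module.End ℂ (Fin n → ℂ))
        (φ : Module.Dual ℂ (Fin n → ℂ)) (v : Fin n → ℂ),
        (∀ (ψ : Module.Dual ℂ (Fin n → ℂ)) (w : Fin n → ℂ),
          ∃ c : A, ∀ u : U, pair u c = ψ (ρ u w)) ∧
        ∀ u : U, pair u x = φ (ρ u v)})
    (hsemis : ∀ (n : ℕ) (ρ : U →ₐ[ℂ] Module.End ℂ (Fin n → ℂ)),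
      (∀ (ψ : Module.Dual ℂ (Fin n → ℂ)) (w : Fin n → ℂ),
        ∃ c : A, ∀ u : U, pair u c = ψ (ρ u w)) →
      ∀ W : Submodule ℂ (Fin n → ℂ), (∀ k ∈ K, ∀ w ∈ W, ρ k w ∈ W) →
        ∃ W' : Submodule ℂ (Fin n → ℂ), (∀ k ∈ K, ∀ w ∈ W', ρ k w ∈ W') ∧ IsCompl W W')
    (Bsub : Subalgebra ℂ A)
    (hB : Subalgebra.toSubmodule Bsub = invSubmodule pair K)
    (I : Submodule ℂ ↥Bsub)
    (hIBp : I ≤ BplusB Bsub)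
    (hIcofin : FiniteDimensional ℂ (↥Bsub ⧸ I)) :
    (((∀ b : ↥Bsub, ∀ x ∈ I, b * x ∈ I) ∧ (∀ f ∈ TofI Bsub I, IsDualCoalgElemB Bsub f)) →
      DeltaInto Bsub (TofI Bsub I)) ∧
    (DbarStable Bsub I → KStable pair K Bsub (TofI Bsub I)) ∧
    (((∀ b : ↥Bsub, ∀ x ∈ I, b * x ∈ I) ∧ DbarStable Bsub I) →
      ∀ f ∈ TofI Bsub I, IsDualCoalgElemB Bsub f) ∧
    (Module.finrank ℂ ↥(TofI Bsub I) =
      Module.finrank ℂ (↥(BplusB Bsub) ⧸ Submodule.comap (BplusB Bsub).subtype I) + 1) ∧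
    (IofT Bsub (TofI Bsub I) = I) := by
  have hε : counitB Bsub ≠ 0 := fun h => by
    have h1 := LinearMap.congr_fun h 1
    simp [counitB] at h1
  refine ⟨fun h => deltaInto_of_left_ideal Bsub I h.1, KStable_TofI pair K Bsub hB
    (fun k hk => ABp_le_ker_pair pair hpair_mulA hpair_oneU K hKcoideal Bsub hB hk) I,
    fun h f hf => isDualCoalgElemB_of_left_ideal Bsub I h.1 hf, ?_, ?_⟩
  · rw [TofI_eq_dualAnnihilator, ← I.dualQuotEquivDualAnnihilator.finrank_eq,
      Subspace.dual_finrank_eq]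
    exact finrank_quotient_eq_finrank_ker_quotient_add_one _ hε I hIBp
  · rw [TofI_eq_dualAnnihilator, IofT_eq_dualCoannihilator,
      Subspace.dualAnnihilator_dualCoannihilator_eq]
end
end

section
/- Let T ⊆ B' be a finite-dimensional subspace with ε ∈ T and I_T = {b ∈ B : f(b) = 0 for all f ∈ T} ⊆ B⁺. Then: (1) if T ⊆ B° and Δ(T) ⊆ B° ⊗ T, then B·I_T ⊆ I_T; (2) if TK ⊆ T, then Δ̄(I_T) ⊆ I_T ⊗ Ā; (3) dim T = dim(B⁺/I_T) + 1; (4) T_{I_T} = T. -/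
noncomputable section

open scoped TensorProduct

variable {U A : Type} [Ring U] [HopfAlgebra ℂ U] [Ring A] [HopfAlgebra ℂ A]

section Slices

variable {M N : Type} [AddCommGroup M] [Module ℂ M] [AddCommGroup N] [Module ℂ N]

/-- The slice map `m ⊗ n ↦ φ(m) n`. -/
def sliceL (φ : Module.Dual ℂ M) : M ⊗[ℂ] N →ₗ[ℂ] N :=
  (TensorProduct.lid ℂ N).toLinearMap ∘ₗ φ.rTensor N

/-- The slice map `m ⊗ n ↦ φ(n) m`. -/
def sliceR (φ : Module.Dual ℂ N) : M ⊗[ℂ] N →ₗ[ℂ] M :=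
  (TensorProduct.rid ℂ M).toLinearMap ∘ₗ φ.lTensor M

@[simp]
theorem sliceL_tmul (φ : Module.Dual ℂ M) (m : M) (n : N) :
    sliceL φ (m ⊗ₜ[ℂ] n) = φ m • n := by
  simp [sliceL]

@[simp]
theorem sliceR_tmul (φ : Module.Dual ℂ N) (m : M) (n : N) :
    sliceR φ (m ⊗ₜ[ℂ] n) = φ n • m := by
  simp [sliceR]

theorem mem_range_rTensor_of_sliceR_mem (V : Submodule ℂ M) (z : M ⊗[ℂ] N)
    (h : ∀ φ : Module.Dual ℂ N, sliceR φ z ∈ V) :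
    z ∈ LinearMap.range (V.subtype.rTensor N) := by
  classical
  let w := Module.Basis.ofVectorSpace ℂ N
  obtain ⟨c, rfl⟩ := TensorProduct.eq_repr_basis_right w z
  refine Submodule.sum_mem _ fun i hi => ?_
  have hc : c i ∈ V := by
    rcases eq_or_ne (c i) 0 with h0 | h0
    · simp [h0]
    · simpa [Finsupp.sum, Finsupp.single_apply, h0] using h (w.coord i)
  exact ⟨⟨c i, hc⟩ ⊗ₜ w i, by simp⟩

theorem mem_range_lTensor_of_sliceL_mem (V : Submodule ℂ N) (z : M ⊗[ℂ] N)
    (h : ∀ φ : Module.Dual ℂ M, sliceL φ z ∈ V) :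
    z ∈ LinearMap.range (V.subtype.lTensor M) := by
  classical
  let w := Module.Basis.ofVectorSpace ℂ M
  obtain ⟨c, rfl⟩ := TensorProduct.eq_repr_basis_left w z
  refine Submodule.sum_mem _ fun i hi => ?_
  have hc : c i ∈ V := by
    rcases eq_or_ne (c i) 0 with h0 | h0
    · simp [h0]
    · simpa [Finsupp.sum, Finsupp.single_apply, h0] using h (w.coord i)
  exact ⟨w i ⊗ₜ ⟨c i, hc⟩, by simp⟩

theorem sliceL_mem_of_finite (z : M ⊗[ℂ] N) :
    ∃ V : Submodule ℂ N, FiniteDimensional ℂ V ∧ ∀ φ : Module.Dual ℂ M, sliceL φ z ∈ V := by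
  obtain ⟨S, rfl⟩ := TensorProduct.exists_finset z
  classical
  refine ⟨Submodule.span ℂ (S.image Prod.snd : Finset N),
    FiniteDimensional.span_finset ℂ _, fun φ => ?_⟩
  rw [map_sum]
  refine Submodule.sum_mem _ fun i hi => ?_
  rw [sliceL_tmul]
  exact Submodule.smul_mem _ _ (Submodule.subset_span (by
    simpa using ⟨i.1, hi⟩))

end Slices

section Coalgebra

variable {C : Type} [AddCommGroup C] [Module ℂ C] [Coalgebra ℂ C]

theorem sliceL_comul_sliceL_comul (φ ψ : Module.Dual ℂ C) (x : C) :
    sliceL ψ (Coalgebra.comul (R := ℂ) (sliceL φ (Coalgebra.comul (R := ℂ) x))) =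
      sliceL (LinearMap.mul' ℂ ℂ ∘ₗ TensorProduct.map φ ψ ∘ₗ Coalgebra.comul (R := ℂ))
        (Coalgebra.comul (R := ℂ) x) := by
  have h1 : sliceL ψ ∘ₗ Coalgebra.comul (R := ℂ) ∘ₗ sliceL φ =
      (sliceL φ ∘ₗ (sliceL ψ).lTensor C) ∘ₗ (Coalgebra.comul (R := ℂ) (A := C)).lTensor C := by
    ext a b
    simp
  have h2 : sliceL (LinearMap.mul' ℂ ℂ ∘ₗ TensorProduct.map φ ψ ∘ₗ Coalgebra.comul (R := ℂ)) =
      (sliceL (LinearMap.mul' ℂ ℂ ∘ₗ TensorProduct.map φ ψ)) ∘ₗ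
        (Coalgebra.comul (R := ℂ) (A := C)).rTensor C := by
    ext a b
    simp
  have h3 : sliceL (LinearMap.mul' ℂ ℂ ∘ₗ TensorProduct.map φ ψ) =
      (sliceL φ ∘ₗ (sliceL ψ).lTensor C) ∘ₗ
        (TensorProduct.assoc ℂ C C C).toLinearMap := by
    ext a b c
    simp [smul_smul, mul_comm]
  have := LinearMap.congr_fun h1 (Coalgebra.comul (R := ℂ) x)
  simp only [LinearMap.comp_apply] at this
  rw [this, h2, LinearMap.comp_apply, h3, LinearMap.comp_apply, LinearEquiv.coe_coe,
    Coalgebra.coassoc_apply]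
  rfl

theorem sliceR_sliceL_comul (φ ψ : Module.Dual ℂ C) (x : C) :
    sliceL φ (Coalgebra.comul (R := ℂ) (sliceR ψ (Coalgebra.comul (R := ℂ) x))) =
      sliceR ψ (Coalgebra.comul (R := ℂ) (sliceL φ (Coalgebra.comul (R := ℂ) x))) := by
  have h1 : sliceL φ ∘ₗ Coalgebra.comul (R := ℂ) ∘ₗ sliceR ψ =
      (sliceL φ ∘ₗ (sliceR ψ)) ∘ₗ (Coalgebra.comul (R := ℂ) (A := C)).rTensor C := by
    ext a b
    simp
  have h2 : sliceR ψ ∘ₗ Coalgebra.comul (R := ℂ) ∘ₗ sliceL φ =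
      (sliceL φ ∘ₗ (sliceR ψ).lTensor C) ∘ₗ (Coalgebra.comul (R := ℂ) (A := C)).lTensor C := by
    ext a b
    simp
  have h3 : (sliceL φ ∘ₗ (sliceR ψ) : (C ⊗[ℂ] C) ⊗[ℂ] C →ₗ[ℂ] C) =
      (sliceL φ ∘ₗ (sliceR ψ).lTensor C) ∘ₗ
        (TensorProduct.assoc ℂ C C C).toLinearMap := by
    ext a b c
    simp [smul_smul, mul_comm]
  have e1 := LinearMap.congr_fun h1 (Coalgebra.comul (R := ℂ) x)
  have e2 := LinearMap.congr_fun h2 (Coalgebra.comul (R := ℂ) x)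
  simp only [LinearMap.comp_apply] at e1 e2
  rw [e1, e2, ← LinearMap.comp_apply, h3, LinearMap.comp_apply, LinearEquiv.coe_coe,
    Coalgebra.coassoc_apply]
  rfl

/-- Every element of a coalgebra lies in a finite-dimensional left coideal; in a basis of it,
the coaction is given by a comultiplicative matrix. -/
theorem exists_comatrix (x : C) :
    ∃ (n : ℕ) (e : Fin n → C) (c : Fin n → Fin n → C) (l : Fin n → ℂ),
      x = ∑ j, l j • e j ∧
      (∀ j, Coalgebra.comul (R := ℂ) (e j) = ∑ i, c j i ⊗ₜ[ℂ] e i) ∧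
      (∀ j i, Coalgebra.comul (R := ℂ) (c j i) = ∑ m, c j m ⊗ₜ[ℂ] c m i) ∧
      (∀ j i, Coalgebra.counit (R := ℂ) (c j i) = if j = i then 1 else 0) := by
  classical
  let F : Module.Dual ℂ C →ₗ[ℂ] C :=
    { toFun := fun φ => sliceL φ (Coalgebra.comul (R := ℂ) x)
      map_add' := fun φ ψ => by
        simp [sliceL, LinearMap.rTensor_add]
      map_smul' := fun r φ => by
        simp [sliceL, LinearMap.rTensor_smul] }
  let D := LinearMap.range F
  obtain ⟨V, hV, hVm⟩ := sliceL_mem_of_finite (Coalgebra.comul (R := ℂ) x)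
  have hDV : D ≤ V := by
    rintro _ ⟨φ, rfl⟩
    exact hVm φ
  have : FiniteDimensional ℂ D := Submodule.finiteDimensional_of_le hDV
  have hcounit : ∀ y : C, sliceL (Coalgebra.counit (R := ℂ)) (Coalgebra.comul (R := ℂ) y) = y := by
    intro y
    simp [sliceL]
  have hxD : x ∈ D := ⟨Coalgebra.counit (R := ℂ), hcounit x⟩
  let b := Module.finBasis ℂ D
  have hE : ∀ i, ∃ E : Module.Dual ℂ C, E ∘ₗ D.subtype = b.coord i := fun i =>
    LinearMap.exists_extend (b.coord i)
  choose E hE using hE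
  have hEe : ∀ i j, E i (b j : C) = if j = i then 1 else 0 := by
    intro i j
    have := LinearMap.congr_fun (hE i) (b j)
    simpa [Finsupp.single_apply] using this
  have hsum : ∀ y ∈ D, y = ∑ i, E i y • (b i : C) := by
    intro y hy
    have h1 := congrArg D.subtype (b.sum_repr ⟨y, hy⟩)
    have h2 : ∀ i, E i y = b.repr ⟨y, hy⟩ i := fun i => LinearMap.congr_fun (hE i) ⟨y, hy⟩
    simp only [map_sum, map_smul, Submodule.subtype_apply] at h1
    simp only [h2]
    exact h1.symm
  have hco : ∀ y ∈ D, Coalgebra.comul (R := ℂ) y =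
      ∑ i, sliceR (E i) (Coalgebra.comul (R := ℂ) y) ⊗ₜ[ℂ] (b i : C) := by
    intro y hy
    have hmem : Coalgebra.comul (R := ℂ) y ∈ LinearMap.range (D.subtype.lTensor C) := by
      apply mem_range_lTensor_of_sliceL_mem
      intro ψ
      obtain ⟨φ, rfl⟩ := hy
      exact ⟨_, (sliceL_comul_sliceL_comul φ ψ x).symm⟩
    obtain ⟨z, hz⟩ := hmem
    rw [← hz]
    clear hz
    induction z with
    | zero => simp
    | tmul a d =>
      simp only [LinearMap.lTensor_tmul, sliceR_tmul, TensorProduct.smul_tmul,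
        ← TensorProduct.tmul_sum]
      rw [Submodule.subtype_apply, ← hsum d d.2]
    | add u v hu hv =>
      conv_lhs => rw [map_add, hu, hv]
      simp only [map_add, TensorProduct.add_tmul, Finset.sum_add_distrib]
  refine ⟨_, fun i => b i, fun j i => sliceR (E i) (Coalgebra.comul (R := ℂ) (b j : C)),
    fun i => E i x, hsum x hxD, fun j => hco _ (b j).2, ?_, ?_⟩
  · intro j i
    have h1 : ∀ z : C ⊗[ℂ] C, Coalgebra.comul (R := ℂ) (sliceR (E i) z) =
        sliceR (E i) ((Coalgebra.comul (R := ℂ) (A := C)).rTensor C z) := by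
      intro z
      induction z with
      | zero => simp
      | tmul a d => simp
      | add u v hu hv => simp only [map_add, hu, hv]
    have h2 : (Coalgebra.comul (R := ℂ) (A := C)).rTensor C (Coalgebra.comul (R := ℂ) (b j : C)) =
        (TensorProduct.assoc ℂ C C C).symm
          ((Coalgebra.comul (R := ℂ) (A := C)).lTensor C
            (Coalgebra.comul (R := ℂ) (b j : C))) := by
      rw [Coalgebra.coassoc_symm_apply]
    have h3 : ∀ a : C, ∀ z : C ⊗[ℂ] C,
        sliceR (E i) ((TensorProduct.assoc ℂ C C C).symm (a ⊗ₜ z)) = a ⊗ₜ sliceR (E i) z := by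
      intro a z
      induction z with
      | zero => simp
      | tmul a d => simp
      | add u v hu hv => simp only [TensorProduct.tmul_add, map_add, hu, hv]
    rw [h1, h2, hco _ (b j).2]
    simp only [map_sum, LinearMap.lTensor_tmul, h3]
  · intro j i
    have h1 : ∀ z : C ⊗[ℂ] C, Coalgebra.counit (R := ℂ) (sliceR (E i) z) =
        E i (sliceL (Coalgebra.counit (R := ℂ)) z) := by
      intro z
      induction z with
      | zero => simp
      | tmul a d => simp [mul_comm]
      | add u v hu hv => simp only [map_add, hu, hv]
    rw [h1, hcounit, hEe]

end Coalgebra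

section Comatrix

variable {n : ℕ} {c : Fin n → Fin n → A}

theorem sum_antipode_mul_comatrix
    (hc : ∀ j i, Coalgebra.comul (R := ℂ) (c j i) = ∑ m, c j m ⊗ₜ[ℂ] c m i)
    (hε : ∀ j i, Coalgebra.counit (R := ℂ) (c j i) = if j = i then 1 else 0) (j i : Fin n) :
    ∑ m, HopfAlgebra.antipode ℂ (c j m) * c m i = if j = i then 1 else 0 := by
  have h := HopfAlgebra.mul_antipode_rTensor_comul_apply (R := ℂ) (c j i)
  rw [hc, hε] at h
  simpa [apply_ite (algebraMap ℂ A)] using h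

theorem sum_comatrix_mul_antipode
    (hc : ∀ j i, Coalgebra.comul (R := ℂ) (c j i) = ∑ m, c j m ⊗ₜ[ℂ] c m i)
    (hε : ∀ j i, Coalgebra.counit (R := ℂ) (c j i) = if j = i then 1 else 0) (j i : Fin n) :
    ∑ m, c j m * HopfAlgebra.antipode ℂ (c m i) = if j = i then 1 else 0 := by
  have h := HopfAlgebra.mul_antipode_lTensor_comul_apply (R := ℂ) (c j i)
  rw [hc, hε] at h
  simpa [apply_ite (algebraMap ℂ A)] using h

theorem comul_antipode_comatrix
    (hc : ∀ j i, Coalgebra.comul (R := ℂ) (c j i) = ∑ m, c j m ⊗ₜ[ℂ] c m i)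
    (hε : ∀ j i, Coalgebra.counit (R := ℂ) (c j i) = if j = i then 1 else 0) (j i : Fin n) :
    Coalgebra.comul (R := ℂ) (HopfAlgebra.antipode ℂ (c j i)) =
      ∑ m, HopfAlgebra.antipode ℂ (c m i) ⊗ₜ[ℂ] HopfAlgebra.antipode ℂ (c j m) := by
  let X : Matrix (Fin n) (Fin n) (A ⊗[ℂ] A) := Matrix.of fun j i => Coalgebra.comul (R := ℂ) (c j i)
  let L : Matrix (Fin n) (Fin n) (A ⊗[ℂ] A) := Matrix.of fun j i =>
    Coalgebra.comul (R := ℂ) (HopfAlgebra.antipode ℂ (c j i))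
  let Y : Matrix (Fin n) (Fin n) (A ⊗[ℂ] A) := Matrix.of fun j i =>
    ∑ m, HopfAlgebra.antipode ℂ (c m i) ⊗ₜ[ℂ] HopfAlgebra.antipode ℂ (c j m)
  have h1 : L * X = 1 := by
    ext j i
    simp only [Matrix.mul_apply, L, X, Matrix.of_apply, ← Bialgebra.comul_mul, ← map_sum,
      sum_antipode_mul_comatrix hc hε, Matrix.one_apply]
    split_ifs <;> simp
  have h2 : X * Y = 1 := by
    ext j i
    simp only [Matrix.mul_apply, Y, X, Matrix.of_apply, hc, Finset.sum_mul_sum,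
      Algebra.TensorProduct.tmul_mul_tmul]
    rw [Finset.sum_comm]
    have : ∀ p, ∑ m, ∑ l, (c j p * HopfAlgebra.antipode ℂ (c l i)) ⊗ₜ[ℂ]
        (c p m * HopfAlgebra.antipode ℂ (c m l)) =
        (c j p * HopfAlgebra.antipode ℂ (c p i)) ⊗ₜ[ℂ] (1 : A) := by
      intro p
      rw [Finset.sum_comm]
      simp only [← TensorProduct.tmul_sum, sum_comatrix_mul_antipode hc hε]
      rw [Finset.sum_eq_single p]
      · simp
      · intro l _ hl
        simp [hl.symm]
      · simp
    simp only [this, ← TensorProduct.sum_tmul, sum_comatrix_mul_antipode hc hε, Matrix.one_apply]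
    split_ifs <;> simp [Algebra.TensorProduct.one_def]
  have h : L = Y := left_inv_eq_right_inv h1 h2
  exact congrFun (congrFun h j) i

end Comatrix

section Pairing

theorem hitL_apply (pair : U →ₗ[ℂ] A →ₗ[ℂ] ℂ) (k : U) (a : A) :
    hitL pair k a = sliceL (pair k) (Coalgebra.comul (R := ℂ) a) := by
  have : TensorProduct.lift ((LinearMap.lsmul ℂ A).comp (pair k)) = sliceL (pair k) := by
    ext a b
    simp
  exact LinearMap.congr_fun this _

theorem hitL_mul {pair : U →ₗ[ℂ] A →ₗ[ℂ] ℂ}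
    (hpair_mulA : ∀ (x : U) (a b : A), pair x (a * b) =
      LinearMap.mul' ℂ ℂ (TensorProduct.map (pair.flip a) (pair.flip b)
        (Coalgebra.comul (R := ℂ) x)))
    {K : Subalgebra ℂ U} {k : U} {S : Finset (U × ↥(Subalgebra.toSubmodule K))}
    (hk : Coalgebra.comul (R := ℂ) k = ∑ s ∈ S, s.1 ⊗ₜ[ℂ] (s.2 : U)) (a b : A) :
    hitL pair k (a * b) = ∑ s ∈ S, hitL pair s.1 a * hitL pair s.2 b := by
  simp only [hitL_apply, Bialgebra.comul_mul]
  generalize Coalgebra.comul (R := ℂ) a = x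
  generalize Coalgebra.comul (R := ℂ) b = y
  induction x with
  | zero => simp
  | add x x' hx hx' => simp only [add_mul, map_add, hx, hx', Finset.sum_add_distrib]
  | tmul a a' =>
    induction y with
    | zero => simp
    | add y y' hy hy' => simp only [mul_add, map_add, hy, hy', Finset.sum_add_distrib]
    | tmul b b' =>
      simp [hpair_mulA, hk, Finset.sum_smul, smul_smul, mul_comm]

/-- A `K`-stable subspace of a representation splits off by a matrix commuting with `K`; here the
subspace is the one spanned by the functionals `⟨k, ·⟩`, `k ∈ K`. -/
theorem exists_equivariant_projection
    {pair : U →ₗ[ℂ] A →ₗ[ℂ] ℂ}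
    (hpair_mulU : ∀ (x y : U) (a : A), pair (x * y) a =
      LinearMap.mul' ℂ ℂ (TensorProduct.map (pair x) (pair y) (Coalgebra.comul (R := ℂ) a)))
    (hpair_oneU : ∀ a : A, pair 1 a = Coalgebra.counit (R := ℂ) a)
    {K : Subalgebra ℂ U}
    (hsemis : ∀ (n : ℕ) (ρ : U →ₐ[ℂ] Module.End ℂ (Fin n → ℂ)),
      (∀ (ψ : Module.Dual ℂ (Fin n → ℂ)) (w : Fin n → ℂ),
        ∃ c : A, ∀ u : U, pair u c = ψ (ρ u w)) →
      ∀ W : Submodule ℂ (Fin n → ℂ), (∀ k ∈ K, ∀ w ∈ W, ρ k w ∈ W) →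
        ∃ W' : Submodule ℂ (Fin n → ℂ), (∀ k ∈ K, ∀ w ∈ W', ρ k w ∈ W') ∧ IsCompl W W')
    {n : ℕ} {e : Fin n → A} {c : Fin n → Fin n → A}
    (he : ∀ j, Coalgebra.comul (R := ℂ) (e j) = ∑ i, c j i ⊗ₜ[ℂ] e i)
    (hc : ∀ j i, Coalgebra.comul (R := ℂ) (c j i) = ∑ m, c j m ⊗ₜ[ℂ] c m i)
    (hε : ∀ j i, Coalgebra.counit (R := ℂ) (c j i) = if j = i then 1 else 0) :
    ∃ P : Fin n → Fin n → ℂ,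
      (∀ k ∈ K, ∀ j i, ∑ m, pair k (c j m) * P m i = ∑ m, P j m * pair k (c m i)) ∧
      (∀ k ∈ K, ∀ j, ∑ m, P j m * pair k (e m) = 0) ∧
      (∀ l : Fin n → ℂ, (∀ k ∈ K, ∑ m, l m * pair k (e m) = 0) →
        ∀ i, ∑ m, l m * P m i = l i) := by
  classical
  let R : U →ₐ[ℂ] Matrix (Fin n) (Fin n) ℂ := AlgHom.ofLinearMap
    { toFun := fun u => Matrix.of fun j i => pair u (c j i)
      map_add' := fun u v => by ext; simp
      map_smul' := fun r u => by ext; simp }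
    (by
      ext j i
      simp [hpair_oneU, hε, Matrix.one_apply])
    (by
      intro u v
      ext j i
      simp [hpair_mulU, hc, Matrix.mul_apply])
  let ρ : U →ₐ[ℂ] Module.End ℂ (Fin n → ℂ) := (Matrix.toLinAlgEquiv' (R := ℂ)).toAlgHom.comp R
  have hρ : ∀ u w j, ρ u w j = ∑ i, pair u (c j i) * w i := by
    intro u w j
    rfl
  let f : U →ₗ[ℂ] (Fin n → ℂ) := LinearMap.pi fun j => pair.flip (e j)
  have hf : ∀ u j, f u j = pair u (e j) := fun u j => rfl
  let W := (Subalgebra.toSubmodule K).map f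
  have hWK : ∀ k ∈ K, ∀ w ∈ W, ρ k w ∈ W := by
    rintro k hk _ ⟨u, hu, rfl⟩
    refine ⟨k * u, K.mul_mem hk hu, ?_⟩
    ext j
    rw [hρ, hf, hpair_mulU, he]
    simp [hf]
  obtain ⟨W', hW', hcompl⟩ := hsemis n ρ
    (by
      intro ψ w
      refine ⟨∑ j, ∑ i, (ψ (Pi.single j 1) * w i) • c j i, fun u => ?_⟩
      conv_rhs => rw [LinearMap.pi_apply_eq_sum_univ ψ (ρ u w)]
      simp only [map_sum, map_smul, hρ, smul_eq_mul, Finset.sum_mul]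
      refine Finset.sum_congr rfl fun j _ => Finset.sum_congr rfl fun i _ => ?_
      have : (fun j' => if j = j' then (1 : ℂ) else 0) = Pi.single j 1 := by
        ext j'
        simp [Pi.single_apply, eq_comm]
      rw [this]
      ring) W hWK
  let Q := W'.projection W hcompl.symm
  have hQsum : ∀ w j, Q w j = ∑ i, Q (Pi.single i 1) j * w i := by
    intro w j
    conv_lhs => rw [LinearMap.pi_apply_eq_sum_univ Q w]
    simp only [Finset.sum_apply, Pi.smul_apply, smul_eq_mul]
    refine Finset.sum_congr rfl fun i _ => ?_
    have : (fun j' => if i = j' then (1 : ℂ) else 0) = Pi.single i 1 := by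
      ext j'
      simp [Pi.single_apply, eq_comm]
    rw [this, mul_comm]
  have hQW : ∀ w ∈ W, Q w = 0 := fun w hw =>
    (Submodule.projection_apply_eq_zero_iff hcompl.symm).2 hw
  have hQW' : ∀ w ∈ W', Q w = w := fun w hw =>
    Submodule.projection_apply_left hcompl.symm ⟨w, hw⟩
  have hcomm : ∀ k ∈ K, ∀ w, ρ k (Q w) = Q (ρ k w) := by
    intro k hk w
    obtain ⟨a, ha, b, hb, rfl⟩ := Submodule.mem_sup.1
      (show w ∈ W ⊔ W' from hcompl.sup_eq_top ▸ Submodule.mem_top)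
    simp only [map_add, hQW a ha, hQW' b hb, hQW _ (hWK k hk a ha), hQW' _ (hW' k hk b hb), map_zero]
  refine ⟨fun j i => Q (Pi.single i 1) j, ?_, ?_, ?_⟩
  · intro k hk j i
    have h := congrFun (hcomm k hk (Pi.single i 1)) j
    rw [hρ, hQsum] at h
    rw [h]
    refine Finset.sum_congr rfl fun m _ => ?_
    rw [hρ]
    simp [Pi.single_apply]
  · intro k hk j
    have h := congrFun (hQW (f k) ⟨k, hk, rfl⟩) j
    rw [hQsum] at h
    exact h
  · intro l hl i
    have h : Pi.single i 1 - Q (Pi.single i 1) ∈ W := Submodule.sub_projection_mem hcompl.symm _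
    obtain ⟨k, hk, hke⟩ := h
    have h2 := hl k hk
    have h3 : ∀ m, pair k (e m) = (Pi.single i 1 : Fin n → ℂ) m - Q (Pi.single i 1) m :=
      fun m => congrFun hke m
    simp only [h3, mul_sub, Finset.sum_sub_distrib, Pi.single_apply] at h2
    simp only [mul_ite, mul_one, mul_zero, Finset.sum_ite_eq',
      Finset.mem_univ, if_true] at h2
    exact (sub_eq_zero.1 h2).symm

theorem mem_iff_hitL_eq_smul {pair : U →ₗ[ℂ] A →ₗ[ℂ] ℂ}
    (hpair_oneU : ∀ a : A, pair 1 a = Coalgebra.counit (R := ℂ) a)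
    {K : Subalgebra ℂ U} {Bsub : Subalgebra ℂ A}
    (hB : Subalgebra.toSubmodule Bsub = invSubmodule pair K) (b : A) :
    b ∈ Bsub ↔ ∀ k ∈ K, hitL pair k b = Coalgebra.counit (R := ℂ) k • b := by
  have h1 : hitL pair 1 b = b := by
    have : pair 1 = Coalgebra.counit (R := ℂ) (A := A) := LinearMap.ext hpair_oneU
    rw [hitL_apply, this]
    simp [sliceL]
  have h2 : ∀ k, hitL pair (k - algebraMap ℂ U (Coalgebra.counit (R := ℂ) k)) b =
      hitL pair k b - Coalgebra.counit (R := ℂ) k • hitL pair 1 b := by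
    intro k
    simp [hitL_apply, Algebra.algebraMap_eq_smul_one, sliceL, LinearMap.rTensor_sub,
      LinearMap.rTensor_smul]
  rw [← Subalgebra.mem_toSubmodule, hB]
  simp only [invSubmodule, Submodule.mem_iInf, LinearMap.mem_ker, h2, h1, sub_eq_zero, Subtype.forall]

/-- The annihilator of `K` in `A` is contained in `A B⁺`. -/
theorem mem_ABp_of_pair_eq_zero
    {pair : U →ₗ[ℂ] A →ₗ[ℂ] ℂ}
    (hpair_mulU : ∀ (x y : U) (a : A), pair (x * y) a =
      LinearMap.mul' ℂ ℂ (TensorProduct.map (pair x) (pair y) (Coalgebra.comul (R := ℂ) a)))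
    (hpair_mulA : ∀ (x : U) (a b : A), pair x (a * b) =
      LinearMap.mul' ℂ ℂ (TensorProduct.map (pair.flip a) (pair.flip b)
        (Coalgebra.comul (R := ℂ) x)))
    (hpair_oneU : ∀ a : A, pair 1 a = Coalgebra.counit (R := ℂ) a)
    (hpair_oneA : ∀ x : U, pair x 1 = Coalgebra.counit (R := ℂ) x)
    {K : Subalgebra ℂ U}
    (hKcoideal : ∀ k ∈ K, Coalgebra.comul (R := ℂ) k ∈
      LinearMap.range (TensorProduct.map (LinearMap.id (R := ℂ) (M := U))
        (Subalgebra.toSubmodule K).subtype))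
    (hsemis : ∀ (n : ℕ) (ρ : U →ₐ[ℂ] Module.End ℂ (Fin n → ℂ)),
      (∀ (ψ : Module.Dual ℂ (Fin n → ℂ)) (w : Fin n → ℂ),
        ∃ c : A, ∀ u : U, pair u c = ψ (ρ u w)) →
      ∀ W : Submodule ℂ (Fin n → ℂ), (∀ k ∈ K, ∀ w ∈ W, ρ k w ∈ W) →
        ∃ W' : Submodule ℂ (Fin n → ℂ), (∀ k ∈ K, ∀ w ∈ W', ρ k w ∈ W') ∧ IsCompl W W')
    {Bsub : Subalgebra ℂ A}
    (hB : Subalgebra.toSubmodule Bsub = invSubmodule pair K)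
    {x : A} (hx : ∀ k ∈ K, pair k x = 0) : x ∈ ABp Bsub := by
  classical
  obtain ⟨n, e, c, l, hxe, he, hc, hε⟩ := exists_comatrix x
  obtain ⟨P, hPcomm, hPe, hPl⟩ :=
    exists_equivariant_projection hpair_mulU hpair_oneU hsemis he hc hε
  have hKrep : ∀ k ∈ K, ∃ S : Finset (U × ↥(Subalgebra.toSubmodule K)),
      Coalgebra.comul (R := ℂ) k = ∑ s ∈ S, s.1 ⊗ₜ[ℂ] (s.2 : U) := by
    intro k hk
    obtain ⟨z, hz⟩ := hKcoideal k hk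
    obtain ⟨S, rfl⟩ := TensorProduct.exists_finset z
    exact ⟨S, by rw [← hz]; simp⟩
  let p : Fin n → A := fun j => ∑ i, P j i • e i
  let m : Fin n → A := fun j => ∑ i, HopfAlgebra.antipode ℂ (c j i) * p i
  have hp : ∀ k ∈ K, ∀ i, pair k (p i) = 0 := by
    intro k hk i
    simpa [p] using hPe k hk i
  have hhite : ∀ k j, hitL pair k (e j) = ∑ i, pair k (c j i) • e i := by
    intro k j
    simp [hitL_apply, he]
  have hhitp : ∀ k ∈ K, ∀ i, hitL pair k (p i) = ∑ t, pair k (c i t) • p t := by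
    intro k hk i
    simp only [p, map_sum, map_smul, hhite, Finset.smul_sum, smul_smul]
    rw [Finset.sum_comm]
    conv_rhs => rw [Finset.sum_comm]
    refine Finset.sum_congr rfl fun j _ => ?_
    rw [← Finset.sum_smul, ← Finset.sum_smul, hPcomm k hk]
  have hhits : ∀ k j i, hitL pair k (HopfAlgebra.antipode ℂ (c j i)) =
      ∑ q, pair k (HopfAlgebra.antipode ℂ (c q i)) • HopfAlgebra.antipode ℂ (c j q) := by
    intro k j i
    simp [hitL_apply, comul_antipode_comatrix hc hε]
  have hmB : ∀ j, m j ∈ Bsub := by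
    intro j
    rw [mem_iff_hitL_eq_smul hpair_oneU hB]
    intro k hk
    obtain ⟨S, hS⟩ := hKrep k hk
    have hsum : ∀ q t, ∑ i, ∑ s ∈ S, pair s.1 (HopfAlgebra.antipode ℂ (c q i)) * pair s.2 (c i t) =
        if q = t then Coalgebra.counit (R := ℂ) k else 0 := by
      intro q t
      have h := congrArg (pair k) (sum_antipode_mul_comatrix hc hε q t)
      rw [map_sum] at h
      simp only [hpair_mulA, hS, map_sum, TensorProduct.map_tmul, LinearMap.mul'_apply,
        LinearMap.flip_apply] at h
      rw [h]
      split_ifs <;> simp [hpair_oneA]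
    calc hitL pair k (m j)
        = ∑ i, ∑ s ∈ S, ∑ q, ∑ t, (pair s.1 (HopfAlgebra.antipode ℂ (c q i)) *
            pair s.2 (c i t)) • (HopfAlgebra.antipode ℂ (c j q) * p t) := by
          simp only [m, map_sum]
          refine Finset.sum_congr rfl fun i _ => ?_
          rw [hitL_mul hpair_mulA hS]
          refine Finset.sum_congr rfl fun s _ => ?_
          rw [hhits, hhitp _ s.2.2, Finset.sum_mul_sum]
          simp only [smul_mul_smul_comm]
      _ = ∑ q, ∑ t, (∑ i, ∑ s ∈ S, pair s.1 (HopfAlgebra.antipode ℂ (c q i)) *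
            pair s.2 (c i t)) • (HopfAlgebra.antipode ℂ (c j q) * p t) := by
          simp only [Finset.sum_smul]
          simp only [Finset.sum_comm (s := S)]
          rw [Finset.sum_comm]
          refine Finset.sum_congr rfl fun q _ => ?_
          rw [Finset.sum_comm]
      _ = Coalgebra.counit (R := ℂ) k • m j := by
          simp [hsum, m, Finset.smul_sum]
  have hmε : ∀ j, Coalgebra.counit (R := ℂ) (m j) = 0 := by
    intro j
    have h0 : ∀ i, Coalgebra.counit (R := ℂ) (p i) = 0 := fun i => by
      rw [← hpair_oneU, hp 1 K.one_mem]
    simp [m, h0]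
  have hpm : ∀ j, p j = ∑ i, c j i * m i := by
    intro j
    simp only [m, Finset.mul_sum, ← mul_assoc]
    rw [Finset.sum_comm]
    simp only [← Finset.sum_mul, sum_comatrix_mul_antipode hc hε]
    simp
  have hxp : x = ∑ j, l j • p j := by
    have hl := hPl l (fun k hk => by
      have := hx k hk
      rw [hxe] at this
      simpa using this)
    simp only [p, Finset.smul_sum, smul_smul]
    rw [Finset.sum_comm]
    simp only [← Finset.sum_smul, hl]
    exact hxe
  rw [hxp]
  refine Submodule.sum_mem _ fun j _ => Submodule.smul_mem _ _ ?_
  rw [hpm]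
  exact Submodule.sum_mem _ fun i _ => Submodule.subset_span ⟨_, _, hmB i, hmε i, rfl⟩

/-- `Δ(B) ⊆ B ⊗ A`. -/
theorem exists_coaction {pair : U →ₗ[ℂ] A →ₗ[ℂ] ℂ}
    (hpair_oneU : ∀ a : A, pair 1 a = Coalgebra.counit (R := ℂ) a)
    {K : Subalgebra ℂ U} {Bsub : Subalgebra ℂ A}
    (hB : Subalgebra.toSubmodule Bsub = invSubmodule pair K) (b : Bsub) :
    ∃ z : ↥Bsub ⊗[ℂ] A, TensorProduct.map Bsub.val.toLinearMap LinearMap.id z =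
      Coalgebra.comul (R := ℂ) (b : A) := by
  refine mem_range_rTensor_of_sliceR_mem (Subalgebra.toSubmodule Bsub) _ fun φ => ?_
  rw [Subalgebra.mem_toSubmodule, mem_iff_hitL_eq_smul hpair_oneU hB]
  intro k hk
  have hb := (mem_iff_hitL_eq_smul hpair_oneU hB _).1 b.2 k hk
  rw [hitL_apply] at hb
  rw [hitL_apply, sliceR_sliceL_comul, hb, map_smul, map_smul]

end Pairing

/-- second Proposition of Section 1.  Let `T ⊆ B'` be a
finite-dimensional subspace with `ε ∈ T`, and let
`I_T = {b ∈ B : f(b) = 0 for all f ∈ T} ⊆ B⁺`.  Then: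
(1) if `T ⊆ B°` and `Δ(T) ⊆ B° ⊗ T`, then `B·I_T ⊆ I_T`;
(2) if `TK ⊆ T`, then `Δ̄(I_T) ⊆ I_T ⊗ Ā`;
(3) `dim T = dim(B⁺/I_T) + 1`;  (4) `T_{I_T} = T`. -/
theorem properties_of_IofT
    (pair : U →ₗ[ℂ] A →ₗ[ℂ] ℂ)
    (hpair_mulU : ∀ (x y : U) (a : A), pair (x * y) a =
      LinearMap.mul' ℂ ℂ (TensorProduct.map (pair x) (pair y) (Coalgebra.comul (R := ℂ) a)))
    (hpair_mulA : ∀ (x : U) (a b : A), pair x (a * b) =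
      LinearMap.mul' ℂ ℂ (TensorProduct.map (pair.flip a) (pair.flip b)
        (Coalgebra.comul (R := ℂ) x)))
    (hpair_oneU : ∀ a : A, pair 1 a = Coalgebra.counit (R := ℂ) a)
    (hpair_oneA : ∀ x : U, pair x 1 = Coalgebra.counit (R := ℂ) x)
    (hpair_antipode : ∀ (x : U) (a : A),
      pair (HopfAlgebra.antipode (R := ℂ) x) a = pair x (HopfAlgebra.antipode (R := ℂ) a))
    (hsep : ∀ x : U, (∀ a : A, pair x a = 0) → x = 0)
    (hSbij : Function.Bijective (HopfAlgebra.antipode (R := ℂ) (A := U)))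
    (K : Subalgebra ℂ U)
    (hKcoideal : ∀ k ∈ K, Coalgebra.comul (R := ℂ) k ∈
      LinearMap.range (TensorProduct.map (LinearMap.id (R := ℂ) (M := U))
        (Subalgebra.toSubmodule K).subtype))
    (hAspan : ∀ a : A, a ∈ Submodule.span ℂ
      {x : A | ∃ (n : ℕ) (ρ : U →ₐ[ℂ] Module.End ℂ (Fin n → ℂ))
        (φ : Module.Dual ℂ (Fin n → ℂ)) (v : Fin n → ℂ),
        (∀ (ψ : Module.Dual ℂ (Fin n → ℂ)) (w : Fin n → ℂ),
          ∃ c : A, ∀ u : U, pair u c = ψ (ρ u w)) ∧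
        ∀ u : U, pair u x = φ (ρ u v)})
    (hsemis : ∀ (n : ℕ) (ρ : U →ₐ[ℂ] Module.End ℂ (Fin n → ℂ)),
      (∀ (ψ : Module.Dual ℂ (Fin n → ℂ)) (w : Fin n → ℂ),
        ∃ c : A, ∀ u : U, pair u c = ψ (ρ u w)) →
      ∀ W : Submodule ℂ (Fin n → ℂ), (∀ k ∈ K, ∀ w ∈ W, ρ k w ∈ W) →
        ∃ W' : Submodule ℂ (Fin n → ℂ), (∀ k ∈ K, ∀ w ∈ W', ρ k w ∈ W') ∧ IsCompl W W')
    (Bsub : Subalgebra ℂ A)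
    (hB : Subalgebra.toSubmodule Bsub = invSubmodule pair K)
    (T : Submodule ℂ (Module.Dual ℂ ↥Bsub))
    (hTfin : FiniteDimensional ℂ ↥T)
    (hepsT : counitB Bsub ∈ T) :
    (((∀ f ∈ T, IsDualCoalgElemB Bsub f) ∧ DeltaInto Bsub T) →
      ∀ b : ↥Bsub, ∀ x ∈ IofT Bsub T, b * x ∈ IofT Bsub T) ∧
    (KStable pair K Bsub T → DbarStable Bsub (IofT Bsub T)) ∧
    (Module.finrank ℂ ↥T =
      Module.finrank ℂ
        (↥(BplusB Bsub) ⧸ Submodule.comap (BplusB Bsub).subtype (IofT Bsub T)) + 1) ∧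
    (TofI Bsub (IofT Bsub T) = T) := by
  have hI : IofT Bsub T = T.dualCoannihilator := by
    ext x
    simp [IofT, Submodule.mem_dualCoannihilator]
  have hmemI : ∀ x, x ∈ IofT Bsub T ↔ ∀ f ∈ T, f x = 0 := by
    intro x
    rw [hI, Submodule.mem_dualCoannihilator]
  have hTofI : TofI Bsub (IofT Bsub T) = (IofT Bsub T).dualAnnihilator := by
    ext f
    simp [TofI, Submodule.mem_dualAnnihilator]
  refine ⟨?_, ?_, ?_, ?_⟩
  · rintro ⟨-, hΔ⟩ b x hx
    rw [hmemI] at hx ⊢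
    intro f hf
    obtain ⟨n, g, h, -, hh, hfgh⟩ := hΔ f hf
    rw [hfgh]
    exact Finset.sum_eq_zero fun i _ => by rw [hx _ (hh i), mul_zero]
  · intro hK x hx
    let q := (ABp Bsub).mkQ
    have hinj : Function.Injective (TensorProduct.map Bsub.val.toLinearMap
        (LinearMap.id (R := ℂ) (M := A))) :=
      Module.Flat.rTensor_preserves_injective_linearMap (M := A) Bsub.val.toLinearMap
        Subtype.val_injective
    choose δ hδ using exists_coaction hpair_oneU hB
    let Δ : ↥Bsub →ₗ[ℂ] ↥Bsub ⊗[ℂ] A :=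
      { toFun := δ
        map_add' := fun a b => hinj (by simp [hδ])
        map_smul' := fun r a => hinj (by simp [hδ]) }
    have hslice : ∀ f ∈ T, q (sliceL f (Δ x)) = 0 := by
      intro f hf
      rw [Submodule.mkQ_apply, Submodule.Quotient.mk_eq_zero]
      refine mem_ABp_of_pair_eq_zero hpair_mulU hpair_mulA hpair_oneU hpair_oneA hKcoideal hsemis hB
        fun k hk => ?_
      have hg : IsDualAct pair Bsub f k (pair k ∘ₗ sliceL f ∘ₗ Δ) := by
        intro b c hc
        have hcb : c = Δ b := hinj (hc.trans (hδ b).symm)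
        rw [LinearMap.comp_apply, LinearMap.comp_apply, ← hcb]
        clear hc hcb
        induction c with
        | zero => simp
        | tmul a d => simp
        | add u v hu hv => simp only [map_add, hu, hv]
      exact (hmemI x).1 hx _ (hK f hf k hk _ hg)
    have hmem : q.lTensor ↥Bsub (Δ x) ∈
        LinearMap.range ((IofT Bsub T).subtype.rTensor (A ⧸ ABp Bsub)) := by
      refine mem_range_rTensor_of_sliceR_mem _ _ fun φ => ?_
      rw [hmemI]
      intro f hf
      have h : ∀ z : ↥Bsub ⊗[ℂ] A, f (sliceR φ (q.lTensor ↥Bsub z)) = φ (q (sliceL f z)) := by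
        intro z
        induction z with
        | zero => simp
        | tmul a b => simp [mul_comm]
        | add u v hu hv => simp only [map_add, hu, hv]
      rw [h, hslice f hf, map_zero]
    obtain ⟨z, hz⟩ := hmem
    refine ⟨z, ?_⟩
    have h1 : TensorProduct.map (Bsub.val.toLinearMap ∘ₗ (IofT Bsub T).subtype)
        (LinearMap.id (R := ℂ) (M := A ⧸ ABp Bsub)) =
        Bsub.val.toLinearMap.rTensor _ ∘ₗ (IofT Bsub T).subtype.rTensor _ := by
      rw [← LinearMap.rTensor_comp]
      rfl
    have h2 : DbarB Bsub x = Bsub.val.toLinearMap.rTensor _ (q.lTensor ↥Bsub (Δ x)) := by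
      have h3 : Bsub.val.toLinearMap.rTensor _ ∘ₗ q.lTensor ↥Bsub =
          q.lTensor A ∘ₗ TensorProduct.map Bsub.val.toLinearMap LinearMap.id := by
        ext a b
        simp
      have h4 := LinearMap.congr_fun h3 (Δ x)
      simp only [LinearMap.comp_apply] at h4
      rw [h4]
      simp only [Δ, LinearMap.coe_mk, AddHom.coe_mk, hδ]
      rfl
    rw [h1, h2, LinearMap.comp_apply, hz]
  · let I := IofT Bsub T
    have hIε : I ≤ LinearMap.ker (counitB Bsub) := fun x hx => (hmemI x).1 hx _ hepsT
    have hfinT : Module.finrank ℂ T = Module.finrank ℂ (↥Bsub ⧸ I) := by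
      rw [← Subspace.dual_finrank_eq (K := ℂ) (V := T), show I = T.dualCoannihilator from hI]
      exact (LinearEquiv.ofBijective _
        (Subspace.quotDualCoannihilatorToDual_bijective T)).finrank_eq.symm
    have : FiniteDimensional ℂ (↥Bsub ⧸ I) := by
      rw [show I = T.dualCoannihilator from hI]
      exact Subspace.finiteDimensional_quot_dualCoannihilator_iff.2 hTfin
    let η : (↥Bsub ⧸ I) →ₗ[ℂ] ℂ := I.liftQ (counitB Bsub) hIε
    have hη : Function.Surjective η := fun r =>
      ⟨I.mkQ (algebraMap ℂ Bsub r), by simp [η, counitB]⟩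
    let g : ↥(BplusB Bsub) →ₗ[ℂ] (↥Bsub ⧸ I) := I.mkQ ∘ₗ (BplusB Bsub).subtype
    have hkerg : LinearMap.ker g = Submodule.comap (BplusB Bsub).subtype I := by
      rw [LinearMap.ker_comp, Submodule.ker_mkQ]
    have hrangeg : LinearMap.range g = LinearMap.ker η := by
      rw [LinearMap.range_comp, Submodule.range_subtype, Submodule.ker_liftQ]
      rfl
    have hrank := LinearMap.finrank_range_add_finrank_ker η
    rw [LinearMap.range_eq_top.2 hη, finrank_top, Module.finrank_self, ← hrangeg,
      ← g.quotKerEquivRange.finrank_eq, hkerg] at hrank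
    rw [hfinT, ← hrank, add_comm]
  · rw [hTofI, hI]
    exact Subspace.dualCoannihilator_dualAnnihilator_eq
end
end
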